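/- Let m, n, ℓ be integers with m ≥ 6, n ≥ m, 0 ≤ ℓ ≤ m, and set Δ = 4mn − ℓ². Then Σ_{ℓ̃=0}^{m−1} 2·c_m^F(−1, ℓ̃)·(ℓ̃² + 4m)^{23/4}·I_{23/2}(π√(Δ(ℓ̃² + 4m))/m) < 0.3·c_m^F(−1, m)·(m² + 4m)^{23/4}·I_{23/2}(π√(Δ(m² + 4m))/m), where c_m^F(−1, ℓ̃) = Σ_{r≥1} (2r + ℓ̃)·d(m − r² − rℓ̃) for 0 ≤ ℓ̃ ≤ m (a finite sum, since d vanishes below −1), so in particular c_m^F(−1, m) = m + 2. -/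

import Mathlib

open Real

/-- The modified Bessel function of the first kind. -/
noncomputable def besselI (ν x : ℝ) : ℝ :=
  ∑' k : ℕ, (x / 2) ^ (2 * (k : ℝ) + ν) / ((k.factorial : ℝ) * Real.Gamma ((k : ℝ) + ν + 1))

/-- `d n`: the coefficient of `q^(n+1)` in `∏ (1 - q^j)^{-24}`. -/
def dcoef (n : ℤ) : ℤ :=
  if 0 ≤ n + 1 then
    ∑ v ∈ Finset.Nat.antidiagonalTuple 24 (n + 1).toNat,
      ∏ i, (Fintype.card (Nat.Partition (v i)) : ℤ)
  else 0

/-- `c_m^F(−1, ℓ̃) = Σ_{r ≥ 1} (2r + ℓ̃) · d(m − r² − rℓ̃)`, a finite sum since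
`d` vanishes below `−1`. -/
noncomputable def cFm1 (m ℓt : ℤ) : ℤ :=
  ∑ᶠ r : ℤ, if 1 ≤ r then (2 * r + ℓt) * dcoef (m - r ^ 2 - r * ℓt) else 0

theorem card_partition_count_ge (n i j : ℕ) (hi : 1 ≤ i) :
    (Finset.univ.filter fun q : n.Partition => j ≤ q.parts.count i).card =
      if i * j ≤ n then Fintype.card (n - i * j).Partition else 0 := by
  split_ifs with h
  · rw [← Finset.card_univ]
    refine Finset.card_bij'
      (fun q hq => ⟨q.parts - Multiset.replicate j i, fun hx =>
        q.parts_pos (Multiset.mem_of_le (Multiset.sub_le_self _ _) hx), ?_⟩)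
      (fun q _ => ⟨q.parts + Multiset.replicate j i, fun hx => ?_, ?_⟩) ?_ ?_ ?_ ?_
    · have hle : Multiset.replicate j i ≤ q.parts :=
        Multiset.le_count_iff_replicate_le.1 (Finset.mem_filter.1 hq).2
      have := congrArg Multiset.sum (Multiset.sub_add_cancel hle)
      rw [Multiset.sum_add, q.parts_sum, Multiset.sum_replicate, smul_eq_mul, mul_comm j i] at this
      omega
    · rcases Multiset.mem_add.1 hx with hx | hx
      · exact q.parts_pos hx
      · rw [Multiset.eq_of_mem_replicate hx]; exact hi
    · rw [Multiset.sum_add, q.parts_sum, Multiset.sum_replicate, smul_eq_mul, mul_comm j i]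
      omega
    · intro q hq; exact Finset.mem_univ _
    · intro q _
      simp
    · intro q hq
      have hle : Multiset.replicate j i ≤ q.parts :=
        Multiset.le_count_iff_replicate_le.1 (Finset.mem_filter.1 hq).2
      ext1
      exact Multiset.sub_add_cancel hle
    · intro q _
      ext1
      exact Multiset.add_sub_cancel_right
  · rw [Finset.card_eq_zero, Finset.filter_eq_empty_iff]
    intro q _ hq
    have hle := Multiset.le_count_iff_replicate_le.1 hq
    have := congrArg Multiset.sum (Multiset.sub_add_cancel hle)
    rw [Multiset.sum_add, q.parts_sum, Multiset.sum_replicate, smul_eq_mul, mul_comm j i] at this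
    omega

theorem count_parts_le {n : ℕ} (q : n.Partition) {i : ℕ} (hi : 1 ≤ i) : q.parts.count i ≤ n := by
  have hle := Multiset.le_count_iff_replicate_le.1 (le_refl (q.parts.count i))
  have := congrArg Multiset.sum (Multiset.sub_add_cancel hle)
  rw [Multiset.sum_add, q.parts_sum, Multiset.sum_replicate, smul_eq_mul] at this
  have := Nat.le_mul_of_pos_right (q.parts.count i) hi
  omega

theorem sum_count_mul {n : ℕ} (q : n.Partition) :
    ∑ i ∈ Finset.Icc 1 n, q.parts.count i * i = n := by
  conv_rhs => rw [← q.parts_sum, Finset.sum_multiset_count]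
  simp only [smul_eq_mul]
  symm
  refine Finset.sum_subset (fun i hi => ?_) (fun i _ hi => ?_)
  · rw [Multiset.mem_toFinset] at hi
    exact Finset.mem_Icc.2 ⟨q.parts_pos hi, Nat.Partition.le_of_mem_parts hi⟩
  · rw [Multiset.mem_toFinset] at hi
    rw [Multiset.count_eq_zero_of_notMem hi, zero_mul]

/-- Euler's recurrence for the partition function. -/
theorem mul_card_partition (n : ℕ) :
    n * Fintype.card n.Partition =
      ∑ k ∈ Finset.Icc 1 n, (∑ i ∈ k.divisors, i) * Fintype.card (n - k).Partition := by
  have hcount : ∀ (q : n.Partition), ∀ i ∈ Finset.Icc 1 n,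
      q.parts.count i * i = ∑ j ∈ Finset.Icc 1 n, if j ≤ q.parts.count i then i else 0 := by
    intro q i hi
    have hle := count_parts_le q (Finset.mem_Icc.1 hi).1
    rw [← Finset.sum_filter, Finset.sum_const, smul_eq_mul]
    congr 1
    have : (Finset.Icc 1 n).filter (fun j => j ≤ q.parts.count i) =
        Finset.Icc 1 (q.parts.count i) := by
      ext j; simp only [Finset.mem_filter, Finset.mem_Icc]; omega
    rw [this, Nat.card_Icc]; omega
  calc n * Fintype.card n.Partition
      = ∑ q : n.Partition, ∑ i ∈ Finset.Icc 1 n, ∑ j ∈ Finset.Icc 1 n,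
          if j ≤ q.parts.count i then i else 0 := by
        rw [Finset.sum_congr rfl fun q _ =>
          (Finset.sum_congr rfl (hcount q)).symm.trans (sum_count_mul q)]
        rw [Finset.sum_const, Finset.card_univ, smul_eq_mul, mul_comm]
    _ = ∑ i ∈ Finset.Icc 1 n, ∑ j ∈ Finset.Icc 1 n,
          if i * j ≤ n then i * Fintype.card (n - i * j).Partition else 0 := by
        rw [Finset.sum_comm]
        refine Finset.sum_congr rfl fun i hi => ?_
        rw [Finset.sum_comm]
        refine Finset.sum_congr rfl fun j _ => ?_
        rw [← Finset.sum_filter, Finset.sum_const, smul_eq_mul,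
          card_partition_count_ge n i j (Finset.mem_Icc.1 hi).1]
        split_ifs <;> ring
    _ = ∑ k ∈ Finset.Icc 1 n, ∑ x ∈ k.divisorsAntidiagonal,
          x.1 * Fintype.card (n - k).Partition := by
        rw [← Finset.sum_product', ← Finset.sum_filter, Finset.sum_sigma']
        refine Finset.sum_bij' (fun x _ => ⟨x.1 * x.2, x⟩) (fun x _ => x.2) ?_ ?_ ?_ ?_ ?_
        · rintro ⟨i, j⟩ h
          simp only [Finset.mem_filter, Finset.mem_product, Finset.mem_Icc] at h
          simp only [Finset.mem_sigma, Finset.mem_Icc, Nat.mem_divisorsAntidiagonal, true_and]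
          have : 1 ≤ i * j := Nat.mul_pos h.1.1.1 h.1.2.1
          omega
        · rintro ⟨k, i, j⟩ h
          simp only [Finset.mem_sigma, Finset.mem_Icc, Nat.mem_divisorsAntidiagonal] at h
          simp only [Finset.mem_filter, Finset.mem_product, Finset.mem_Icc]
          obtain ⟨⟨h1, h2⟩, h3, h4⟩ := h
          have hi : 1 ≤ i := Nat.pos_of_ne_zero (by rintro rfl; simp at h3; omega)
          have hj : 1 ≤ j := Nat.pos_of_ne_zero (by rintro rfl; simp at h3; omega)
          refine ⟨⟨⟨hi, ?_⟩, hj, ?_⟩, ?_⟩ <;> nlinarith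
        · rintro ⟨i, j⟩ _; rfl
        · rintro ⟨k, i, j⟩ h
          simp only [Finset.mem_sigma, Nat.mem_divisorsAntidiagonal] at h
          obtain ⟨_, rfl, _⟩ := h
          rfl
        · rintro ⟨i, j⟩ _; rfl
    _ = _ := by
        refine Finset.sum_congr rfl fun k _ => ?_
        rw [Nat.sum_divisorsAntidiagonal (fun i _ => i * Fintype.card (n - k).Partition),
          Finset.sum_mul]

/-- The coefficient of `q ^ n` in `∏ (1 - q ^ j) ^ (-24)`. -/
def coloredPartitions (n : ℕ) : ℕ :=
  ∑ v ∈ Finset.Nat.antidiagonalTuple 24 n, ∏ i, Fintype.card (Nat.Partition (v i))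

open PowerSeries in
theorem coeff_partition_pow (n : ℕ) :
    coeff n ((PowerSeries.mk fun k => (Fintype.card k.Partition : ℤ)) ^ 24) =
      (coloredPartitions n : ℤ) := by
  have h := coeff_prod (fun _ : Fin 24 => PowerSeries.mk fun k => (Fintype.card k.Partition : ℤ)) n
    Finset.univ
  rw [Finset.prod_const, Finset.card_univ, Fintype.card_fin] at h
  rw [h, coloredPartitions]
  push_cast
  refine Finset.sum_bij' (fun v _ => ⇑v) (fun v _ => Finsupp.equivFunOnFinite.symm v) ?_ ?_ ?_ ?_ ?_
  · intro v hv
    rw [Finset.mem_finsuppAntidiag] at hv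
    exact Finset.Nat.mem_antidiagonalTuple.2 hv.1
  · intro v hv
    rw [Finset.mem_finsuppAntidiag]
    exact ⟨Finset.Nat.mem_antidiagonalTuple.1 hv, Finset.subset_univ _⟩
  · intro v _; ext; rfl
  · intro v _; rfl
  · intro v _; simp

open PowerSeries in
theorem mul_coloredPartitions (n : ℕ) :
    n * coloredPartitions n =
      24 * ∑ k ∈ Finset.Icc 1 n, (∑ i ∈ k.divisors, i) * coloredPartitions (n - k) := by
  set P : ℤ⟦X⟧ := PowerSeries.mk fun k => (Fintype.card k.Partition : ℤ) with hP
  set S : ℤ⟦X⟧ := PowerSeries.mk fun k => ((∑ i ∈ k.divisors, i : ℕ) : ℤ) with hS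
  have hX : ∀ (Q : ℤ⟦X⟧) (n : ℕ), coeff n (X * d⁄dX ℤ Q) = n * coeff n Q := by
    intro Q n
    cases n with
    | zero => simp
    | succ n => rw [coeff_succ_X_mul, coeff_derivative]; push_cast; ring
  have hmul : ∀ (Q : ℤ⟦X⟧) (n : ℕ), coeff n (S * Q) =
      ∑ k ∈ Finset.Icc 1 n, ((∑ i ∈ k.divisors, i : ℕ) : ℤ) * coeff (n - k) Q := by
    intro Q n
    rw [coeff_mul, Finset.Nat.sum_antidiagonal_eq_sum_range_succ (fun i j => coeff i S * coeff j Q),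
      Finset.sum_range_succ', Finset.range_eq_Ico, Finset.sum_Ico_add' (fun i => coeff i S * coeff (n - i) Q)]
    simp [hS]
    rfl
  have hEuler : X * d⁄dX ℤ P = S * P := by
    ext n
    rw [hX, hmul]
    simp only [hP, coeff_mk]
    exact_mod_cast mul_card_partition n
  have hpow : X * d⁄dX ℤ (P ^ 24) = 24 * (S * P ^ 24) := by
    rw [Derivation.leibniz_pow]
    simp only [nsmul_eq_mul, smul_eq_mul]
    linear_combination 24 * P ^ 23 * hEuler
  have h := congrArg (coeff n) hpow
  rw [hX, show (24 : ℤ⟦X⟧) = C (24 : ℤ) by simp, coeff_C_mul, hmul] at h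
  simp only [hP, coeff_partition_pow] at h
  exact_mod_cast h

/-- The entire function `∑ u ^ k / (k! Γ(k + a))`, for which
`I_ν(x) = (x / 2) ^ ν * besselSeries (ν + 1) (x ^ 2 / 4)`. -/
noncomputable def besselSeries (a u : ℝ) : ℝ :=
  ∑' k : ℕ, u ^ k / ((k.factorial : ℝ) * Real.Gamma (k + a))

theorem one_le_Gamma {x : ℝ} (hx : 2 ≤ x) : 1 ≤ Real.Gamma x := by
  rw [← Real.Gamma_two]
  exact Real.Gamma_strictMonoOn_Ici.monotoneOn (Set.mem_Ici.2 le_rfl) (Set.mem_Ici.2 hx) hx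

theorem norm_besselSeries_term_le {a : ℝ} (ha : 2 ≤ a) (u : ℝ) (k : ℕ) :
    ‖u ^ k / ((k.factorial : ℝ) * Real.Gamma (k + a))‖ ≤ |u| ^ k / (k.factorial : ℝ) := by
  have hk : (0 : ℝ) < k.factorial := by positivity
  have hG : 1 ≤ Real.Gamma (k + a) := one_le_Gamma (by linarith [k.cast_nonneg (α := ℝ)])
  rw [norm_div, norm_pow, Real.norm_eq_abs, Real.norm_of_nonneg (by positivity)]
  gcongr
  nlinarith

theorem summable_besselSeries {a : ℝ} (ha : 2 ≤ a) (u : ℝ) :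
    Summable fun k : ℕ => u ^ k / ((k.factorial : ℝ) * Real.Gamma (k + a)) :=
  .of_norm_bounded (Real.summable_pow_div_factorial |u|) (norm_besselSeries_term_le ha u)

theorem besselSeries_pos {a : ℝ} (ha : 2 ≤ a) {u : ℝ} (hu : 0 ≤ u) : 0 < besselSeries a u := by
  have hG : ∀ k : ℕ, 0 < Real.Gamma (k + a) := fun k => Real.Gamma_pos_of_pos (by positivity)
  refine (summable_besselSeries ha u).tsum_pos (fun k => ?_) 0 ?_
  · have := hG k; positivity
  · have := hG 0; simp only [pow_zero]; positivity

theorem succ_mul_besselSeries_coeff (a u : ℝ) (k : ℕ) :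
    ((k + 1 : ℕ) : ℝ) * u ^ k / (((k + 1).factorial : ℝ) * Real.Gamma ((k + 1 : ℕ) + a)) =
      u ^ k / ((k.factorial : ℝ) * Real.Gamma (k + (a + 1))) := by
  rw [Nat.factorial_succ, show ((k + 1 : ℕ) : ℝ) + a = k + (a + 1) by push_cast; ring,
    Nat.cast_mul, mul_assoc, mul_div_mul_left _ _ (by positivity)]

theorem hasDerivAt_besselSeries {a : ℝ} (ha : 2 ≤ a) (u : ℝ) :
    HasDerivAt (besselSeries a) (besselSeries (a + 1) u) u := by
  set R : ℝ := |u| + 1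
  have hterm : ∀ (y : ℝ), y ∈ Metric.ball (0 : ℝ) R → ∀ k : ℕ,
      ‖((k + 1 : ℕ) : ℝ) * y ^ k / (((k + 1).factorial : ℝ) * Real.Gamma ((k + 1 : ℕ) + a))‖ ≤
        R ^ k / (k.factorial : ℝ) := by
    intro y hy k
    rw [succ_mul_besselSeries_coeff]
    refine (norm_besselSeries_term_le (by linarith) y k).trans ?_
    rw [mem_ball_zero_iff, Real.norm_eq_abs] at hy
    gcongr
  have hu : u ∈ Metric.ball (0 : ℝ) R := by
    rw [mem_ball_zero_iff, Real.norm_eq_abs]; exact lt_add_one _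
  have hbound : Summable fun k : ℕ => if k = 0 then (0 : ℝ) else R ^ (k - 1) / ((k - 1).factorial : ℝ) := by
    rw [← summable_nat_add_iff 1]
    simpa using Real.summable_pow_div_factorial R
  have h := hasDerivAt_tsum_of_isPreconnected (𝕜 := ℝ)
    (g := fun (k : ℕ) y => y ^ k / ((k.factorial : ℝ) * Real.Gamma (k + a)))
    (g' := fun (k : ℕ) y => (k : ℝ) * y ^ (k - 1) / ((k.factorial : ℝ) * Real.Gamma (k + a)))
    hbound Metric.isOpen_ball (convex_ball (0 : ℝ) R).isPreconnected
    (fun k y _ => (hasDerivAt_pow k y).div_const _) ?_ hu (summable_besselSeries ha u) hu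
  · refine HasDerivAt.congr_deriv h ?_
    rw [Summable.tsum_eq_zero_add]
    · simp only [CharP.cast_eq_zero, zero_mul, zero_div, zero_add, add_tsub_cancel_right]
      exact tsum_congr fun k => succ_mul_besselSeries_coeff a u k
    · rw [← summable_nat_add_iff 1]
      refine .of_norm_bounded (Real.summable_pow_div_factorial R) fun k => ?_
      simpa using hterm u hu k
  · intro k y hy
    cases k with
    | zero => simp
    | succ k => simpa using hterm y hy k

theorem besselSeries_recurrence {a : ℝ} (ha : 2 ≤ a) (u : ℝ) :
    besselSeries a u = a * besselSeries (a + 1) u + u * besselSeries (a + 2) u := by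
  have h1 := summable_besselSeries (show 2 ≤ a + 1 by linarith) u
  have h2 := summable_besselSeries (show 2 ≤ a + 2 by linarith) u
  have hG : ∀ k : ℕ, Real.Gamma (k + (a + 1)) = (k + a) * Real.Gamma (k + a) := fun k => by
    rw [← add_assoc, Real.Gamma_add_one (by positivity)]
  have hpos : ∀ k : ℕ, 0 < Real.Gamma (k + a) := fun k => Real.Gamma_pos_of_pos (by positivity)
  have hk : Summable fun k : ℕ => (k : ℝ) * (u ^ k / ((k.factorial : ℝ) * Real.Gamma (k + (a + 1)))) := by
    rw [← summable_nat_add_iff 1]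
    refine (h2.mul_left u).congr fun k => ?_
    rw [show a + 2 = (a + 1) + 1 by ring, ← succ_mul_besselSeries_coeff (a + 1), pow_succ]
    ring
  have hshift : ∑' k : ℕ, (k : ℝ) * (u ^ k / ((k.factorial : ℝ) * Real.Gamma (k + (a + 1)))) =
      u * besselSeries (a + 2) u := by
    rw [hk.tsum_eq_zero_add, besselSeries, ← tsum_mul_left]
    simp only [CharP.cast_eq_zero, zero_mul, zero_add]
    refine tsum_congr fun k => ?_
    rw [show a + 2 = (a + 1) + 1 by ring, ← succ_mul_besselSeries_coeff (a + 1), pow_succ]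
    ring
  rw [← hshift, besselSeries, besselSeries, ← tsum_mul_left, ← (h1.mul_left a).tsum_add hk]
  refine tsum_congr fun k => ?_
  have := hpos k
  have : (0 : ℝ) < k + a := by positivity
  rw [hG]
  field_simp
  ring

/-- `√x I_{23/2}(x) e^{-x}` is increasing on the positive axis. -/
theorem besselSeries_mul_exp_mono {x y : ℝ} (hx : 0 ≤ x) (hxy : x ≤ y) :
    x ^ 12 * besselSeries (25 / 2) (x ^ 2 / 4) * Real.exp (-x) ≤
      y ^ 12 * besselSeries (25 / 2) (y ^ 2 / 4) * Real.exp (-y) := by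
  have hsq : ∀ z : ℝ, HasDerivAt (fun z : ℝ => z ^ 2 / 4) (z / 2) z := fun z =>
    ((hasDerivAt_pow 2 z).div_const 4).congr_deriv (by norm_num; ring)
  have hH : ∀ z : ℝ, HasDerivAt (fun z => besselSeries (25 / 2) (z ^ 2 / 4))
      (besselSeries (27 / 2) (z ^ 2 / 4) * (z / 2)) z := fun z => by
    have := (hasDerivAt_besselSeries (a := 25 / 2) (by norm_num) (z ^ 2 / 4)).comp z (hsq z)
    norm_num at this; exact this
  have hH' : ∀ z : ℝ, HasDerivAt (fun z => besselSeries (27 / 2) (z ^ 2 / 4))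
      (besselSeries (29 / 2) (z ^ 2 / 4) * (z / 2)) z := fun z => by
    have := (hasDerivAt_besselSeries (a := 27 / 2) (by norm_num) (z ^ 2 / 4)).comp z (hsq z)
    norm_num at this; exact this
  have hrec : ∀ z : ℝ, besselSeries (25 / 2) (z ^ 2 / 4) =
      25 / 2 * besselSeries (27 / 2) (z ^ 2 / 4) +
        z ^ 2 / 4 * besselSeries (29 / 2) (z ^ 2 / 4) := fun z => by
    have := besselSeries_recurrence (a := 25 / 2) (by norm_num) (z ^ 2 / 4)
    norm_num at this; exact this
  have hpos : ∀ z : ℝ, 0 < besselSeries (25 / 2) (z ^ 2 / 4) := fun z =>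
    besselSeries_pos (by norm_num) (by positivity)
  -- with `f z = z ^ 12 * besselSeries (25 / 2) (z ^ 2 / 4)`, this is `e ^ z * (deriv f z - f z)`
  set F : ℝ → ℝ := fun z => Real.exp z * (12 * z ^ 11 * besselSeries (25 / 2) (z ^ 2 / 4) +
    z ^ 13 / 2 * besselSeries (27 / 2) (z ^ 2 / 4) -
      z ^ 12 * besselSeries (25 / 2) (z ^ 2 / 4)) with hF
  have hFd : ∀ z : ℝ, HasDerivAt F
      (Real.exp z * (132 * z ^ 10 * besselSeries (25 / 2) (z ^ 2 / 4))) z := fun z => by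
    have h := (Real.hasDerivAt_exp z).mul
      (((((hasDerivAt_pow 11 z).const_mul 12).mul (hH z)).add
        (((hasDerivAt_pow 13 z).div_const 2).mul (hH' z))).sub ((hasDerivAt_pow 12 z).mul (hH z)))
    refine h.congr_deriv ?_
    simp only [Pi.add_apply, Pi.sub_apply, Pi.mul_apply]
    norm_num
    linear_combination (-Real.exp z * z ^ 12) * hrec z
  have hFmono : Monotone F := monotone_of_hasDerivAt_nonneg hFd fun z => by
    have := hpos z
    have : (0 : ℝ) ≤ z ^ 10 := by positivity
    show 0 ≤ _
    positivity
  have hF0 : F 0 = 0 := by simp [hF]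
  set G : ℝ → ℝ := fun z => z ^ 12 * besselSeries (25 / 2) (z ^ 2 / 4) * Real.exp (-z) with hG
  have hGd : ∀ z : ℝ, HasDerivAt G (Real.exp (-z) * Real.exp (-z) * F z) z := fun z => by
    have h := ((hasDerivAt_pow 12 z).mul (hH z)).mul ((hasDerivAt_neg z).exp)
    refine h.congr_deriv ?_
    have he : Real.exp (-z) * Real.exp z = 1 := by rw [← Real.exp_add]; simp
    simp only [Pi.mul_apply, hF]
    norm_num
    linear_combination (-Real.exp (-z) * (12 * z ^ 11 * besselSeries (25 / 2) (z ^ 2 / 4) +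
      z ^ 13 / 2 * besselSeries (27 / 2) (z ^ 2 / 4) -
        z ^ 12 * besselSeries (25 / 2) (z ^ 2 / 4))) * he
  have hGmono : MonotoneOn G (Set.Ici 0) := by
    refine monotoneOn_of_deriv_nonneg (convex_Ici 0)
      (fun z _ => (hGd z).continuousAt.continuousWithinAt)
      (fun z _ => (hGd z).differentiableAt.differentiableWithinAt) fun z hz => ?_
    rw [interior_Ici] at hz
    rw [(hGd z).deriv]
    have : 0 ≤ F z := hF0 ▸ hFmono (le_of_lt hz)
    positivity
  exact hGmono (Set.mem_Ici.2 hx) (Set.mem_Ici.2 (hx.trans hxy)) hxy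

theorem besselI_eq {ν x : ℝ} (hx : 0 < x) :
    besselI ν x = (x / 2) ^ ν * besselSeries (ν + 1) (x ^ 2 / 4) := by
  rw [besselI, besselSeries, ← tsum_mul_left]
  refine tsum_congr fun k => ?_
  have h2 : (0 : ℝ) < x / 2 := by positivity
  rw [Real.rpow_add h2, Real.rpow_mul h2.le, Real.rpow_natCast, Real.rpow_two, add_assoc,
    show (x / 2) ^ 2 = x ^ 2 / 4 by ring]
  ring

theorem rpow_mul_besselI_eq {κ w : ℝ} (hκ : 0 < κ) (hw : 0 < w) :
    w ^ ((23 : ℝ) / 4) * besselI (23 / 2) (κ * √w) =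
      (κ / 2) ^ ((23 : ℝ) / 2) * √w ^ 23 * besselSeries (25 / 2) ((κ * √w) ^ 2 / 4) := by
  have hs : 0 < √w := Real.sqrt_pos.2 hw
  rw [besselI_eq (by positivity), show κ * √w / 2 = κ / 2 * √w by ring,
    Real.mul_rpow (by positivity) hs.le]
  have h1 : w ^ ((23 : ℝ) / 4) * √w ^ ((23 : ℝ) / 2) = √w ^ 23 := by
    nth_rewrite 1 [← Real.sq_sqrt hw.le]
    rw [← Real.rpow_natCast (√w) 2, ← Real.rpow_mul hs.le, ← Real.rpow_add hs,
      ← Real.rpow_natCast]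
    norm_num
  rw [← h1]
  norm_num
  ring

theorem rpow_mul_besselI_pos {κ w : ℝ} (hκ : 0 < κ) (hw : 0 < w) :
    0 < w ^ ((23 : ℝ) / 4) * besselI (23 / 2) (κ * √w) := by
  rw [rpow_mul_besselI_eq hκ hw]
  have := besselSeries_pos (a := 25 / 2) (by norm_num) (show 0 ≤ (κ * √w) ^ 2 / 4 by positivity)
  have := Real.sqrt_pos.2 hw
  positivity

theorem rpow_mul_besselI_le {κ c w w' : ℝ} (hκ : 0 < κ) (hc : c ≤ κ) (hw : 0 < w) (hww : w ≤ w') :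
    w ^ ((23 : ℝ) / 4) * besselI (23 / 2) (κ * √w) ≤
      w' ^ ((23 : ℝ) / 4) * besselI (23 / 2) (κ * √w') *
        ((√w / √w') ^ 11 * Real.exp (-(c * (√w' - √w)))) := by
  have hs : 0 < √w := Real.sqrt_pos.2 hw
  have hss : √w ≤ √w' := Real.sqrt_le_sqrt hww
  have hs' : 0 < √w' := hs.trans_le hss
  rw [rpow_mul_besselI_eq hκ hw, rpow_mul_besselI_eq hκ (hw.trans_le hww)]
  have h := besselSeries_mul_exp_mono (x := κ * √w) (y := κ * √w') (by positivity) (by gcongr)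
  have hexp : Real.exp (-(κ * √w')) * Real.exp (κ * √w) ≤ Real.exp (-(c * (√w' - √w))) := by
    rw [← Real.exp_add]
    refine Real.exp_le_exp.2 ?_
    nlinarith
  have he : Real.exp (-(κ * √w)) * Real.exp (κ * √w) = 1 := by rw [← Real.exp_add]; simp
  set A := besselSeries (25 / 2) ((κ * √w) ^ 2 / 4)
  have hB : 0 < besselSeries (25 / 2) ((κ * √w') ^ 2 / 4) :=
    besselSeries_pos (by norm_num) (by positivity)
  set B := besselSeries (25 / 2) ((κ * √w') ^ 2 / 4)
  have key : √w ^ 12 * A ≤ √w' ^ 12 * B * Real.exp (-(c * (√w' - √w))) := by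
    have h3 := mul_le_mul_of_nonneg_right h (Real.exp_pos (κ * √w)).le
    rw [mul_assoc, he, mul_one, mul_pow, mul_pow] at h3
    have h4 : κ ^ 12 * (√w ^ 12 * A) ≤
        κ ^ 12 * (√w' ^ 12 * B * (Real.exp (-(κ * √w')) * Real.exp (κ * √w))) := by
      linarith
    exact (le_of_mul_le_mul_left h4 (by positivity)).trans (by gcongr)
  calc (κ / 2) ^ ((23 : ℝ) / 2) * √w ^ 23 * A
      = (κ / 2) ^ ((23 : ℝ) / 2) * √w ^ 11 * (√w ^ 12 * A) := by ring
    _ ≤ (κ / 2) ^ ((23 : ℝ) / 2) * √w ^ 11 *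
          (√w' ^ 12 * B * Real.exp (-(c * (√w' - √w)))) := by gcongr
    _ = _ := by
      rw [div_pow]; field_simp

theorem coloredPartitions_zero : coloredPartitions 0 = 1 := by
  rw [coloredPartitions, Finset.Nat.antidiagonalTuple_zero_right]
  simp

theorem sum_divisors_le_three_pow (k : ℕ) : ∑ i ∈ (k + 1).divisors, i ≤ 3 ^ k := by
  have h1 : ∑ i ∈ (k + 1).divisors, i ≤ ∑ i ∈ Finset.range (k + 2), i :=
    Finset.sum_le_sum_of_subset fun i hi =>
      Finset.mem_range.2 (Nat.lt_succ_of_le (Nat.divisor_le hi))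
  refine h1.trans ?_
  clear h1
  induction k with
  | zero => decide
  | succ k ih =>
    have : k + 2 ≤ 2 * 3 ^ k := by
      have := Nat.lt_pow_self (n := k) (a := 3) (by norm_num)
      have : 1 ≤ 3 ^ k := Nat.one_le_pow _ _ (by norm_num)
      omega
    rw [Finset.sum_range_succ, pow_succ]
    omega

theorem coloredPartitions_le (n : ℕ) : coloredPartitions n ≤ 24 ^ n := by
  induction n using Nat.strong_induction_on with
  | _ n ih =>
    rcases Nat.lt_or_ge n 2 with hn | hn
    · interval_cases n
      · rw [coloredPartitions_zero]; norm_num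
      · have := mul_coloredPartitions 1
        simp [coloredPartitions_zero] at this
        omega
    · have hrec := mul_coloredPartitions n
      have hsum : ∑ k ∈ Finset.Icc 1 n, (∑ i ∈ k.divisors, i) * coloredPartitions (n - k) ≤
          ∑ i ∈ Finset.range n, 3 ^ i * 24 ^ (n - 1 - i) := by
        have hshift := Finset.sum_Ico_add' (fun k => (∑ i ∈ k.divisors, i) *
          coloredPartitions (n - k)) 0 n 1
        rw [Finset.range_eq_Ico, ← Finset.Ico_add_one_right_eq_Icc, ← zero_add 1,
          ← add_assoc, add_zero, ← hshift]
        refine Finset.sum_le_sum fun k hk => ?_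
        rw [show n - (k + 1) = n - 1 - k by omega]
        exact Nat.mul_le_mul (sum_divisors_le_three_pow k)
          (ih _ (by have := (Finset.mem_Ico.1 hk).2; omega))
      have hgeom : (∑ i ∈ Finset.range n, 3 ^ i * 24 ^ (n - 1 - i)) * 21 ≤ 24 ^ n := by
        have h := geom_sum₂_mul (3 : ℤ) 24 n
        have h3 : (0 : ℤ) ≤ 3 ^ n := by positivity
        zify
        linarith
      have h2 : 2 * coloredPartitions n ≤ n * coloredPartitions n := Nat.mul_le_mul_right _ hn
      omega

/-- The values of `coloredPartitions` below `36`. -/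
def coloredPartitionsTable : List ℕ :=
  [1, 24, 324, 3200, 25650, 176256, 1073720, 5930496, 30178575, 143184000, 639249300, 2705114880,
    10914317934, 42189811200, 156883829400, 563116739584, 1956790259235, 6599620022400,
    21651325216200, 69228721526400, 216108718571250, 659641645039360, 1971466420726656,
    5776331152550400, 16610409114771900, 46925988716146176, 130362155499200220,
    356418628326241024, 959788304511313500, 2547447689037081600, 6668597583531616856,
    17227666361525437440, 43946595512833354821, 110753578062185091200, 275889636433651636800,
    679603117953171550464]

theorem coloredPartitions_eq_table {n : ℕ} (hn : n < 36) :
    coloredPartitions n = coloredPartitionsTable.getD n 0 := by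
  have hcheck : ∀ n < 36, 1 ≤ n → n * coloredPartitionsTable.getD n 0 =
      24 * ∑ k ∈ Finset.Icc 1 n, (∑ i ∈ k.divisors, i) * coloredPartitionsTable.getD (n - k) 0 := by
    decide +kernel
  induction n using Nat.strong_induction_on with
  | _ n ih =>
    rcases Nat.eq_zero_or_pos n with rfl | hpos
    · exact coloredPartitions_zero
    · refine Nat.eq_of_mul_eq_mul_left hpos ?_
      rw [mul_coloredPartitions, hcheck n hn hpos]
      congr 1
      refine Finset.sum_congr rfl fun k hk => ?_
      rw [ih (n - k) (by have := (Finset.mem_Icc.1 hk).1; omega) (by omega)]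

/-- The sum `∑ (2 r + l) d(M - r ^ 2 - r l)` over `1 ≤ r ≤ M + 1`, with `r = i + 1`, for a sequence
`a n` in place of `d(n - 1)`. -/
def polarSum (a : ℕ → ℕ) (M l : ℕ) : ℕ :=
  ∑ i ∈ Finset.range (M + 1), if (i + 1) ^ 2 + (i + 1) * l ≤ M + 1 then
    (2 * (i + 1) + l) * a (M + 1 - ((i + 1) ^ 2 + (i + 1) * l)) else 0

theorem cFm1_natCast (M l : ℕ) : cFm1 M l = polarSum coloredPartitions M l := by
  have hd : ∀ i : ℕ, dcoef ((M : ℤ) - ((i : ℤ) + 1) ^ 2 - ((i : ℤ) + 1) * l) =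
      if (i + 1) ^ 2 + (i + 1) * l ≤ M + 1 then
        (coloredPartitions (M + 1 - ((i + 1) ^ 2 + (i + 1) * l)) : ℤ) else 0 := by
    intro i
    have hiff : (0 ≤ (M : ℤ) - ((i : ℤ) + 1) ^ 2 - ((i : ℤ) + 1) * l + 1) ↔
        (i + 1) ^ 2 + (i + 1) * l ≤ M + 1 := by
      zify
      constructor <;> intro h <;> linarith
    rw [dcoef]
    by_cases h : (i + 1) ^ 2 + (i + 1) * l ≤ M + 1
    · rw [if_pos h, if_pos (hiff.2 h), coloredPartitions]
      have : ((M : ℤ) - ((i : ℤ) + 1) ^ 2 - ((i : ℤ) + 1) * l + 1).toNat =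
          M + 1 - ((i + 1) ^ 2 + (i + 1) * l) := by
        zify [h]
        rw [Int.toNat_of_nonneg (hiff.2 h)]
        ring
      rw [this]
      push_cast
      rfl
    · rw [if_neg h, if_neg (mt hiff.1 h)]
  rw [cFm1, finsum_eq_sum_of_support_subset (s := (Finset.range (M + 1)).image fun i : ℕ => (i : ℤ) + 1)]
  · rw [Finset.sum_image (fun i _ j _ h => by simpa using h), polarSum]
    push_cast
    refine Finset.sum_congr rfl fun i _ => ?_
    rw [if_pos (by omega), hd]
    split_ifs <;> simp
  · intro r hr
    rw [Function.mem_support] at hr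
    have hr1 : 1 ≤ r := by
      by_contra h
      exact hr (if_neg h)
    obtain ⟨i, rfl⟩ : ∃ i : ℕ, r = (i : ℤ) + 1 := ⟨(r - 1).toNat, by omega⟩
    rw [if_pos hr1, hd] at hr
    have : (i + 1) ^ 2 + (i + 1) * l ≤ M + 1 := by
      by_contra h
      rw [if_neg h, mul_zero] at hr
      exact hr rfl
    refine Finset.mem_coe.2 (Finset.mem_image.2 ⟨i, Finset.mem_range.2 ?_, rfl⟩)
    nlinarith

theorem polarSum_self {M : ℕ} (hM : 1 ≤ M) : polarSum coloredPartitions M M = M + 2 := by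
  rw [polarSum, Finset.sum_range_succ', Finset.sum_eq_zero]
  · simp [coloredPartitions_zero, add_comm]
  · intro i _
    rw [if_neg]
    nlinarith

theorem polarSum_congr {a b : ℕ → ℕ} {M : ℕ} (h : ∀ n ≤ M, a n = b n) (l : ℕ) :
    polarSum a M l = polarSum b M l := by
  refine Finset.sum_congr rfl fun i _ => ?_
  rw [h]
  have : 1 ≤ (i + 1) ^ 2 := Nat.one_le_pow _ _ (by omega)
  omega

theorem polarSum_coloredPartitions_le (j l : ℕ) :
    (polarSum coloredPartitions (l + j + 1) l : ℝ) ≤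
      (l + 2) * (coloredPartitions (j + 1) + 24 ^ j / 23) := by
  have hgeom : ∀ n : ℕ, ∑ i ∈ Finset.range n, (1 / 24 : ℝ) ^ (i + 1) = (1 - (1 / 24) ^ n) / 23 := by
    intro n
    induction n with
    | zero => simp
    | succ n ih => rw [Finset.sum_range_succ, ih]; ring
  have hterm : ∀ i : ℕ, (((if (i + 1 + 1) ^ 2 + (i + 1 + 1) * l ≤ l + j + 1 + 1 then
      (2 * (i + 1 + 1) + l) *
        coloredPartitions (l + j + 1 + 1 - ((i + 1 + 1) ^ 2 + (i + 1 + 1) * l)) else 0 : ℕ)) : ℝ) ≤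
      (l + 2) * 24 ^ j * (1 / 24) ^ (i + 1) := by
    intro i
    split_ifs with h
    · set e := l + j + 1 + 1 - ((i + 1 + 1) ^ 2 + (i + 1 + 1) * l) with he
      have he1 : e + 2 * (i + 1) ≤ j := by
        have h1 : e + ((i + 1 + 1) ^ 2 + (i + 1 + 1) * l) = l + j + 1 + 1 := by omega
        nlinarith
      have h2 : i + 2 ≤ 24 ^ (i + 1) := Nat.lt_pow_self (n := i + 1) (a := 24) (by norm_num)
      have h3 : (i + 2) * 24 ^ e * 24 ^ (i + 1) ≤ 24 ^ j := by
        calc (i + 2) * 24 ^ e * 24 ^ (i + 1) ≤ 24 ^ (i + 1) * 24 ^ e * 24 ^ (i + 1) := by gcongr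
          _ = 24 ^ (e + 2 * (i + 1)) := by ring
          _ ≤ 24 ^ j := Nat.pow_le_pow_right (by norm_num) he1
      have h4 : (2 * (i + 1 + 1) + l) * coloredPartitions e * 24 ^ (i + 1) ≤ (l + 2) * 24 ^ j := by
        calc (2 * (i + 1 + 1) + l) * coloredPartitions e * 24 ^ (i + 1)
            ≤ ((l + 2) * (i + 2)) * 24 ^ e * 24 ^ (i + 1) := by
              gcongr
              · nlinarith
              · exact coloredPartitions_le e
          _ = (l + 2) * ((i + 2) * 24 ^ e * 24 ^ (i + 1)) := by ring
          _ ≤ _ := by gcongr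
      rw [one_div, inv_pow, ← div_eq_mul_inv, le_div_iff₀ (by positivity)]
      exact_mod_cast h4
    · push_cast
      positivity
  rw [polarSum, Finset.sum_range_succ', Nat.cast_add, Nat.cast_sum]
  have hrest := Finset.sum_le_sum fun i (_ : i ∈ Finset.range (l + j + 1)) => hterm i
  rw [← Finset.mul_sum, hgeom] at hrest
  have hle : ((l : ℝ) + 2) * 24 ^ j * ((1 - (1 / 24) ^ (l + j + 1)) / 23) ≤
      (l + 2) * 24 ^ j * (1 / 23) := by
    gcongr
    linarith [show (0 : ℝ) ≤ (1 / 24) ^ (l + j + 1) by positivity]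
  have h0 : (((if (0 + 1) ^ 2 + (0 + 1) * l ≤ l + j + 1 + 1 then
      (2 * (0 + 1) + l) * coloredPartitions (l + j + 1 + 1 - ((0 + 1) ^ 2 + (0 + 1) * l))
        else 0 : ℕ)) : ℝ) = (l + 2) * coloredPartitions (j + 1) := by
    rw [if_pos (by omega), show l + j + 1 + 1 - ((0 + 1) ^ 2 + (0 + 1) * l) = j + 1 by omega]
    push_cast
    ring
  rw [h0]
  linarith

theorem sum_coloredPartitions_le {n : ℕ} (hn : 8 ≤ n) :
    ∑ j ∈ Finset.range n, ((coloredPartitions (j + 1) : ℝ) + 24 ^ j / 23) * (1 / 48) ^ j ≤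
      33 - 50 * (1 / 2) ^ n := by
  induction n, hn using Nat.le_induction with
  | base =>
    simp only [Finset.sum_range_succ, Finset.sum_range_zero]
    simp only [coloredPartitions_eq_table (n := 0 + 1) (by norm_num),
      coloredPartitions_eq_table (n := 1 + 1) (by norm_num),
      coloredPartitions_eq_table (n := 2 + 1) (by norm_num),
      coloredPartitions_eq_table (n := 3 + 1) (by norm_num),
      coloredPartitions_eq_table (n := 4 + 1) (by norm_num),
      coloredPartitions_eq_table (n := 5 + 1) (by norm_num),
      coloredPartitions_eq_table (n := 6 + 1) (by norm_num),
      coloredPartitions_eq_table (n := 7 + 1) (by norm_num)]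
    norm_num [coloredPartitionsTable]
  | succ n _ ih =>
    rw [Finset.sum_range_succ]
    have h1 : (coloredPartitions (n + 1) : ℝ) ≤ 24 ^ (n + 1) := by
      exact_mod_cast coloredPartitions_le (n + 1)
    have h2 : ((coloredPartitions (n + 1) : ℝ) + 24 ^ n / 23) * (1 / 48) ^ n ≤
        25 * (1 / 2) ^ n := by
      calc ((coloredPartitions (n + 1) : ℝ) + 24 ^ n / 23) * (1 / 48) ^ n
          ≤ (25 * 24 ^ n) * (1 / 48) ^ n := by
            gcongr
            rw [pow_succ] at h1
            have : (0 : ℝ) < 24 ^ n := by positivity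
            linarith
        _ = 25 * (24 * (1 / 48)) ^ n := by rw [mul_pow]; ring
        _ = _ := by norm_num
    rw [pow_succ (1 / 2 : ℝ)]
    linarith

theorem le_pi_mul_sqrt_three : 5.441 ≤ π * √3 := by
  have h1 := Real.pi_gt_d4
  have h2 : (1.732 : ℝ) ≤ √3 := Real.le_sqrt_of_sq_le (by norm_num)
  nlinarith

theorem exp_neg_mul_five_sevenths_le : Real.exp (-(π * √3 * (5 / 7))) ≤ 1 / 48 := by
  have h1 : (48 : ℝ) ≤ Real.exp (π * √3 * (5 / 7)) := by
    have hc := le_pi_mul_sqrt_three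
    have h4 : (54.59 : ℝ) ≤ Real.exp 4 := by
      have := Real.exp_one_gt_d9
      have h : Real.exp 4 = Real.exp 1 ^ 4 := by rw [← Real.exp_nat_mul]; norm_num
      rw [h]
      calc (54.59 : ℝ) ≤ 2.718281 ^ 4 := by norm_num
        _ ≤ _ := by gcongr; linarith
    have h5 := Real.add_one_le_exp (-(0.114 : ℝ))
    calc (48 : ℝ) ≤ 54.59 * (-0.114 + 1) := by norm_num
      _ ≤ Real.exp 4 * Real.exp (-0.114) := by gcongr
      _ = Real.exp (3.886) := by rw [← Real.exp_add]; norm_num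
      _ ≤ _ := Real.exp_le_exp.2 (by linarith)
  rw [Real.exp_neg, ← one_div]
  exact one_div_le_one_div_of_le (by norm_num) h1

theorem pow_mul_exp_le {M : ℝ} (hM : 36 ≤ M) :
    ((M + 1) / √(M ^ 2 + 4 * M)) ^ 11 *
      Real.exp (-(π * √3 * (√(M ^ 2 + 4 * M) - (M + 1)))) ≤ 1 / 222 := by
  have hc := le_pi_mul_sqrt_three
  set c := π * √3
  set x := √(M ^ 2 + 4 * M)
  obtain ⟨q, rfl⟩ : ∃ q, M = q - 2 := ⟨M + 2, by ring⟩
  have hq : 38 ≤ q := by linarith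
  have hqinv : 0 < 1 / q := by positivity
  have hqinv' : 1 / q ≤ 1 / 38 := one_div_le_one_div_of_le (by norm_num) hq
  have hqm : q * (1 / q) = 1 := by field_simp
  have hxle : x ≤ q := Real.sqrt_le_iff.2 ⟨by linarith, by nlinarith⟩
  have hxge : q - 2.01 * (1 / q) ≤ x := by
    refine Real.le_sqrt_of_sq_le ?_
    nlinarith
  have hx0 : 0 < x := by nlinarith
  set D := x - (q - 2 + 1)
  have hD : 1 - 2.01 * (1 / q) ≤ D := by simp only [D]; linarith
  have hratio : (q - 2 + 1) / x ≤ Real.exp (-(D * (1 / x))) := by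
    have h := Real.add_one_le_exp (-(D * (1 / x)))
    have : (q - 2 + 1) / x = -(D * (1 / x)) + 1 := by simp only [D]; field_simp; ring
    linarith
  have hxinv : 1 / q ≤ 1 / x := one_div_le_one_div_of_le hx0 hxle
  have hbound : 5.425 ≤ D * (c + 11 * (1 / x)) := by
    calc (5.425 : ℝ) ≤ (1 - 2.01 * (1 / q)) * (5.441 + 11 * (1 / q)) := by nlinarith
      _ ≤ D * (c + 11 * (1 / x)) := by
        have h0 : 0 ≤ 1 - 2.01 * (1 / q) := by linarith
        have hD0 : 0 ≤ D := h0.trans hD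
        gcongr
  have hexp : (222 : ℝ) ≤ Real.exp 5.425 := by
    have h1 := Real.exp_one_gt_d9
    have h5 : Real.exp 5 = Real.exp 1 ^ 5 := by rw [← Real.exp_nat_mul]; norm_num
    have h6 := Real.quadratic_le_exp_of_nonneg (x := 0.425) (by norm_num)
    calc (222 : ℝ) ≤ 2.71828 ^ 5 * (1 + 0.425 + 0.425 ^ 2 / 2) := by norm_num
      _ ≤ Real.exp 1 ^ 5 * Real.exp 0.425 := by gcongr; linarith
      _ = Real.exp 5.425 := by rw [← h5, ← Real.exp_add]; norm_num
  calc ((q - 2 + 1) / x) ^ 11 * Real.exp (-(c * D))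
      ≤ Real.exp (-(D * (1 / x))) ^ 11 * Real.exp (-(c * D)) := by
        have : 0 < q - 2 + 1 := by linarith
        gcongr
    _ = Real.exp (-(D * (c + 11 * (1 / x)))) := by
        rw [← Real.exp_nat_mul, ← Real.exp_add]
        congr 1
        push_cast
        ring
    _ ≤ Real.exp (-5.425) := Real.exp_le_exp.2 (by linarith)
    _ ≤ 1 / 222 := by
        rw [Real.exp_neg, ← one_div]
        exact one_div_le_one_div_of_le (by norm_num) hexp

/-- The bound for the ratio of the Bessel terms at `l` and at `M`. -/
noncomputable def besselRatioBound (M l : ℕ) : ℝ :=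
  (√((l : ℝ) ^ 2 + 4 * M) / √((M : ℝ) ^ 2 + 4 * M)) ^ 11 *
    Real.exp (-(π * √3 * (√((M : ℝ) ^ 2 + 4 * M) - √((l : ℝ) ^ 2 + 4 * M))))

theorem besselRatioBound_nonneg (M l : ℕ) : 0 ≤ besselRatioBound M l := by
  rw [besselRatioBound]; positivity

theorem besselRatioBound_le_of_large {j l : ℕ} (h : 36 ≤ l + j + 1) :
    besselRatioBound (l + j + 1) l ≤ 1 / 222 * (1 / 48) ^ j := by
  have hM : (36 : ℝ) ≤ l + j + 1 := by exact_mod_cast h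
  rw [besselRatioBound]
  push_cast
  set M : ℝ := l + j + 1 with hMdef
  have hl0 : (0 : ℝ) ≤ l := by positivity
  have hj0 : (0 : ℝ) ≤ j := by positivity
  have hy : √((l : ℝ) ^ 2 + 4 * M) ≤ M + 1 - 5 / 7 * j := by
    refine Real.sqrt_le_iff.2 ⟨by linarith, ?_⟩
    have : (l : ℝ) = M - 1 - j := by rw [hMdef]; ring
    rw [this]
    nlinarith
  have hc : 0 < π * √3 := by positivity
  set y := √((l : ℝ) ^ 2 + 4 * M)
  have hp := pow_mul_exp_le hM
  set x := √(M ^ 2 + 4 * M)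
  calc (y / x) ^ 11 * Real.exp (-(π * √3 * (x - y)))
      ≤ ((M + 1) / x) ^ 11 * Real.exp (-(π * √3 * (x - (M + 1))) + j * -(π * √3 * (5 / 7))) := by
        gcongr
        · linarith
        · nlinarith
    _ = (((M + 1) / x) ^ 11 * Real.exp (-(π * √3 * (x - (M + 1))))) *
          Real.exp (-(π * √3 * (5 / 7))) ^ j := by
        rw [Real.exp_add, Real.exp_nat_mul]; ring
    _ ≤ _ := by
        gcongr
        exact exp_neg_mul_five_sevenths_le

theorem sum_polarSum_mul_lt_of_large {M : ℕ} (hM : 36 ≤ M) :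
    ∑ l ∈ Finset.range M, 2 * (polarSum coloredPartitions M l : ℝ) * besselRatioBound M l <
      0.3 * (M + 2) := by
  have hM0 : (0 : ℝ) ≤ M := by positivity
  calc ∑ l ∈ Finset.range M, 2 * (polarSum coloredPartitions M l : ℝ) * besselRatioBound M l
      = ∑ j ∈ Finset.range M, 2 * (polarSum coloredPartitions M (M - 1 - j) : ℝ) *
          besselRatioBound M (M - 1 - j) := (Finset.sum_range_reflect _ M).symm
    _ ≤ ∑ j ∈ Finset.range M, 2 / 222 * (M + 2) *
          (((coloredPartitions (j + 1) : ℝ) + 24 ^ j / 23) * (1 / 48) ^ j) := by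
        refine Finset.sum_le_sum fun j hj => ?_
        obtain ⟨l, rfl⟩ : ∃ l, M = l + j + 1 :=
          ⟨M - 1 - j, by have := Finset.mem_range.1 hj; omega⟩
        rw [show l + j + 1 - 1 - j = l by omega]
        calc 2 * (polarSum coloredPartitions (l + j + 1) l : ℝ) * besselRatioBound (l + j + 1) l
            ≤ 2 * (((l + j + 1 : ℕ) + 2) * (coloredPartitions (j + 1) + 24 ^ j / 23)) *
                (1 / 222 * (1 / 48) ^ j) := by
              gcongr
              · exact besselRatioBound_nonneg _ _
              · refine (polarSum_coloredPartitions_le j l).trans ?_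
                gcongr
                omega
              · exact besselRatioBound_le_of_large hM
          _ = _ := by ring
    _ ≤ 2 / 222 * (M + 2) * (33 - 50 * (1 / 2) ^ M) := by
        rw [← Finset.mul_sum]
        gcongr
        exact sum_coloredPartitions_le (by omega)
    _ < 0.3 * (M + 2) := by
        have : (0 : ℝ) < (1 / 2) ^ M := by positivity
        nlinarith

/-- Newton's iteration for the square root of `n`. -/
def newtonSqrt (n : ℕ) : ℕ → ℕ → ℕ
  | 0, x => x
  | k + 1, x => newtonSqrt n k ((x + n / x) / 2)

/-- An approximation to `128 √(l ^ 2 + 4 M)`. -/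
def sqrtApprox (M l : ℕ) : ℕ :=
  newtonSqrt (128 ^ 2 * (l ^ 2 + 4 * M)) 10 (128 * (M + l))

/-- Lower and upper bounds `X` and `Y l` for `128 √(M ^ 2 + 4 M)` and `128 √(l ^ 2 + 4 M)`, together
with a numerical inequality in which `599 / 625` stands for `exp (-π √3 / 128)`. -/
def NumericalCertificate (M X : ℕ) (Y : ℕ → ℕ) : Prop :=
  0 < X ∧ X ^ 2 ≤ 128 ^ 2 * (M ^ 2 + 4 * M) ∧
    (∀ l < M, Y l ≤ X ∧ 128 ^ 2 * (l ^ 2 + 4 * M) ≤ Y l ^ 2) ∧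
    10 * ∑ l ∈ Finset.range M, 2 * polarSum (fun n => coloredPartitionsTable.getD n 0) M l *
      (Y l ^ 11 * 599 ^ (X - Y l) * 625 ^ Y l) < 3 * (M + 2) * (X ^ 11 * 625 ^ X)

instance (M X : ℕ) (Y : ℕ → ℕ) : Decidable (NumericalCertificate M X Y) :=
  inferInstanceAs (Decidable (_ ∧ _ ∧ _ ∧ _))

theorem numericalCertificate_of_small : ∀ M < 36, 6 ≤ M →
    NumericalCertificate M (sqrtApprox M M) fun l => sqrtApprox M l + 1 := by
  decide +kernel

theorem besselRatioBound_le_of_certificate {M l X Y : ℕ} (hX0 : 0 < X)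
    (hX : X ^ 2 ≤ 128 ^ 2 * (M ^ 2 + 4 * M)) (hYX : Y ≤ X)
    (hY : 128 ^ 2 * (l ^ 2 + 4 * M) ≤ Y ^ 2) :
    besselRatioBound M l ≤ (Y / X : ℝ) ^ 11 * (599 / 625) ^ (X - Y) := by
  have hX0' : (0 : ℝ) < X := by exact_mod_cast hX0
  have hx : (X : ℝ) / 128 ≤ √((M : ℝ) ^ 2 + 4 * M) := by
    refine Real.le_sqrt_of_sq_le ?_
    have : (X : ℝ) ^ 2 ≤ 128 ^ 2 * (M ^ 2 + 4 * M) := by exact_mod_cast hX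
    linarith
  have hy : √((l : ℝ) ^ 2 + 4 * M) ≤ (Y : ℝ) / 128 := by
    refine Real.sqrt_le_iff.2 ⟨by positivity, ?_⟩
    have : 128 ^ 2 * ((l : ℝ) ^ 2 + 4 * M) ≤ Y ^ 2 := by exact_mod_cast hY
    linarith
  have hc := le_pi_mul_sqrt_three
  have hexp : Real.exp (-(π * √3 / 128)) ≤ 599 / 625 := by
    have h1 := Real.quadratic_le_exp_of_nonneg (x := 5.441 / 128) (by norm_num)
    have h2 : (625 / 599 : ℝ) ≤ Real.exp (π * √3 / 128) :=
      calc (625 / 599 : ℝ) ≤ 1 + 5.441 / 128 + (5.441 / 128) ^ 2 / 2 := by norm_num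
        _ ≤ Real.exp (5.441 / 128) := h1
        _ ≤ _ := Real.exp_le_exp.2 (by linarith)
    rw [Real.exp_neg]
    calc (Real.exp (π * √3 / 128))⁻¹ ≤ (625 / 599 : ℝ)⁻¹ := by gcongr
      _ = 599 / 625 := by norm_num
  rw [besselRatioBound]
  set x := √((M : ℝ) ^ 2 + 4 * M)
  set y := √((l : ℝ) ^ 2 + 4 * M)
  have hy0 : 0 ≤ y := Real.sqrt_nonneg _
  have hratio : y / x ≤ Y / X :=
    calc y / x ≤ (Y / 128) / (X / 128) := by gcongr
      _ = Y / X := by field_simp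
  have hrate : Real.exp (-(π * √3 * (x - y))) ≤ Real.exp (-(π * √3 / 128)) ^ (X - Y) := by
    rw [← Real.exp_nat_mul, Nat.cast_sub hYX]
    refine Real.exp_le_exp.2 ?_
    nlinarith
  have hx0 : 0 < x := lt_of_lt_of_le (by positivity) hx
  calc (y / x) ^ 11 * Real.exp (-(π * √3 * (x - y)))
      ≤ (Y / X : ℝ) ^ 11 * Real.exp (-(π * √3 / 128)) ^ (X - Y) := by gcongr
    _ ≤ _ := by gcongr

theorem sum_polarSum_mul_lt_of_certificate {M X : ℕ} {Y : ℕ → ℕ} (hM : M < 36)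
    (h : NumericalCertificate M X Y) :
    ∑ l ∈ Finset.range M, 2 * (polarSum coloredPartitions M l : ℝ) * besselRatioBound M l <
      0.3 * (M + 2) := by
  obtain ⟨hX0, hX, hY, hsum⟩ := h
  have hX0' : (0 : ℝ) < X := by exact_mod_cast hX0
  have hpolar : ∀ l, polarSum coloredPartitions M l =
      polarSum (fun n => coloredPartitionsTable.getD n 0) M l :=
    polarSum_congr fun n hn => coloredPartitions_eq_table (by omega)
  have hpos : (0 : ℝ) < X ^ 11 * 625 ^ X := by positivity
  have hle : (∑ l ∈ Finset.range M, 2 * (polarSum coloredPartitions M l : ℝ) *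
      besselRatioBound M l) * (X ^ 11 * 625 ^ X) ≤
      ((∑ l ∈ Finset.range M, 2 * polarSum (fun n => coloredPartitionsTable.getD n 0) M l *
        (Y l ^ 11 * 599 ^ (X - Y l) * 625 ^ Y l) : ℕ) : ℝ) := by
    rw [Finset.sum_mul, Nat.cast_sum]
    refine Finset.sum_le_sum fun l hl => ?_
    obtain ⟨hYX, hYl⟩ := hY l (Finset.mem_range.1 hl)
    rw [hpolar, mul_assoc]
    push_cast
    refine mul_le_mul_of_nonneg_left ?_ (by positivity)
    calc besselRatioBound M l * ((X : ℝ) ^ 11 * 625 ^ X)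
        ≤ ((Y l / X : ℝ) ^ 11 * (599 / 625) ^ (X - Y l)) * (X ^ 11 * 625 ^ X) := by
          gcongr
          exact besselRatioBound_le_of_certificate hX0 hX hYX hYl
      _ = (Y l : ℝ) ^ 11 * 599 ^ (X - Y l) * 625 ^ Y l := by
          obtain ⟨k, hk⟩ := Nat.exists_eq_add_of_le hYX
          have hpow : (625 : ℝ) ^ X = 625 ^ Y l * 625 ^ k := by rw [← pow_add, ← hk]
          rw [show X - Y l = k by omega, div_pow, div_pow, hpow]
          field_simp
  have hlt : 10 * ((∑ l ∈ Finset.range M,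
      2 * polarSum (fun n => coloredPartitionsTable.getD n 0) M l *
        (Y l ^ 11 * 599 ^ (X - Y l) * 625 ^ Y l) : ℕ) : ℝ) <
      3 * (M + 2) * (X ^ 11 * 625 ^ X) := by
    exact_mod_cast hsum
  refine lt_of_mul_lt_mul_right ?_ hpos.le
  linarith

theorem sum_polarSum_mul_lt {M : ℕ} (hM : 6 ≤ M) :
    ∑ l ∈ Finset.range M, 2 * (polarSum coloredPartitions M l : ℝ) * besselRatioBound M l <
      0.3 * (M + 2) := by
  rcases Nat.lt_or_ge M 36 with h | h
  · exact sum_polarSum_mul_lt_of_certificate h (numericalCertificate_of_small M h hM)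
  · exact sum_polarSum_mul_lt_of_large h

theorem stmt18 (m n ℓ : ℤ) (hm : 6 ≤ m) (hn : m ≤ n) (hℓ0 : 0 ≤ ℓ) (hℓm : ℓ ≤ m) :
    ∑ ℓt ∈ Finset.Ico (0 : ℤ) m,
        2 * (cFm1 m ℓt : ℝ) * ((ℓt ^ 2 + 4 * m : ℤ) : ℝ) ^ ((23 : ℝ) / 4) *
          besselI (23 / 2)
            (Real.pi * Real.sqrt (((4 * m * n - ℓ ^ 2 : ℤ) : ℝ) *
              ((ℓt ^ 2 + 4 * m : ℤ) : ℝ)) / (m : ℝ)) <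
      (0.3 : ℝ) * (cFm1 m m : ℝ) * ((m ^ 2 + 4 * m : ℤ) : ℝ) ^ ((23 : ℝ) / 4) *
        besselI (23 / 2)
          (Real.pi * Real.sqrt (((4 * m * n - ℓ ^ 2 : ℤ) : ℝ) *
            ((m ^ 2 + 4 * m : ℤ) : ℝ)) / (m : ℝ)) := by
  obtain ⟨M, rfl⟩ := Int.eq_ofNat_of_zero_le (show 0 ≤ m by omega)
  have hM : 6 ≤ M := by omega
  have hM0 : (0 : ℝ) < M := by exact_mod_cast (show 0 < M by omega)
  have hΔ : 3 * (M : ℝ) ^ 2 ≤ ((4 * M * n - ℓ ^ 2 : ℤ) : ℝ) := by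
    have : 3 * (M : ℤ) ^ 2 ≤ 4 * M * n - ℓ ^ 2 := by nlinarith
    exact_mod_cast this
  set Δ : ℝ := ((4 * M * n - ℓ ^ 2 : ℤ) : ℝ)
  have hΔ0 : 0 < Δ := lt_of_lt_of_le (by positivity) hΔ
  set κ : ℝ := π * √Δ / M with hκdef
  have hκ : 0 < κ := by positivity
  have hcκ : π * √3 ≤ κ := by
    have : √3 * M ≤ √Δ := Real.le_sqrt_of_sq_le (by
      rw [mul_pow, Real.sq_sqrt (by norm_num)]; exact hΔ)
    rw [hκdef, le_div_iff₀ hM0, mul_assoc]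
    gcongr
  have harg : ∀ w : ℝ, π * √(Δ * w) / M = κ * √w := fun w => by
    rw [Real.sqrt_mul hΔ0.le, hκdef]; ring
  have hIco : Finset.Ico (0 : ℤ) M = (Finset.range M).image fun l : ℕ => (l : ℤ) := by
    ext z
    simp only [Finset.mem_Ico, Finset.mem_image, Finset.mem_range]
    exact ⟨fun h => ⟨z.toNat, by omega, by omega⟩, by rintro ⟨l, hl, rfl⟩; omega⟩
  rw [hIco, Finset.sum_image (fun i _ j _ h => by simpa using h)]
  simp only [Int.cast_natCast, harg, cFm1_natCast, polarSum_self (show 1 ≤ M by omega)]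
  push_cast
  set T : ℝ := ((M : ℝ) ^ 2 + 4 * M) ^ ((23 : ℝ) / 4) *
    besselI (23 / 2) (κ * √((M : ℝ) ^ 2 + 4 * M)) with hT
  have hTpos : 0 < T := rpow_mul_besselI_pos hκ (by positivity)
  calc ∑ l ∈ Finset.range M, 2 * (polarSum coloredPartitions M l : ℝ) *
        ((l : ℝ) ^ 2 + 4 * M) ^ ((23 : ℝ) / 4) * besselI (23 / 2) (κ * √((l : ℝ) ^ 2 + 4 * M))
      ≤ ∑ l ∈ Finset.range M,
          T * (2 * (polarSum coloredPartitions M l : ℝ) * besselRatioBound M l) := by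
        refine Finset.sum_le_sum fun l hl => ?_
        have hlM : (l : ℝ) ≤ M := by exact_mod_cast (Finset.mem_range.1 hl).le
        have h := rpow_mul_besselI_le hκ hcκ (w := (l : ℝ) ^ 2 + 4 * M)
          (w' := (M : ℝ) ^ 2 + 4 * M) (by positivity) (by gcongr)
        have h2 := mul_le_mul_of_nonneg_left h
          (show 0 ≤ 2 * (polarSum coloredPartitions M l : ℝ) by positivity)
        rw [besselRatioBound]
        linarith
    _ < T * (0.3 * (M + 2)) := by
        rw [← Finset.mul_sum]
        exact mul_lt_mul_of_pos_left (sum_polarSum_mul_lt hM) hTpos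
    _ = _ := by rw [hT]; ring
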